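/- Let a ≥ 1 be a real number and let Z(s) = ∑_{n=1}^∞ (n(n+1))^{-s} + 2·∑_{m=1}^∞ ∑_{n=0}^∞ ((a m + n)(a m + n + 1))^{-s}, which converges absolutely for Re(s) > 2. Then every analytic continuation f of this series to the point 0 satisfies f(0) = −1 + a/6 + 1/(6a). -/

import Mathlib

/-- `f` is an analytic continuation to `s₀` of the function `F` given (by an absolutely
convergent series) on the half-plane `{s : Re s > c}`. -/
def IsContinuationAt (F : ℂ → ℂ) (c : ℝ) (s₀ : ℂ) (f : ℂ → ℂ) : Prop :=
  ∃ U : Set ℂ, IsOpen U ∧ IsConnected U ∧ s₀ ∈ U ∧ {s : ℂ | c < s.re} ⊆ U ∧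
    AnalyticOnNhd ℂ f U ∧ ∀ s : ℂ, c < s.re → f s = F s

/-- The spectral zeta function of the Laplacian on the 2-dimensional deformed sphere
`S²_{1/a}`: `Z(s) = ∑_{n≥1} (n(n+1))^{-s} + 2·∑_{m≥1} ∑_{n≥0} ((am+n)(am+n+1))^{-s}`. -/
noncomputable def zetaS2 (a : ℝ) : ℂ → ℂ := fun s =>
  (∑' n : ℕ, (((n : ℂ) + 1) * ((n : ℂ) + 2)) ^ (-s))
    + 2 * ∑' (m : ℕ) (n : ℕ),
        (((a : ℂ) * (m + 1) + n) * ((a : ℂ) * (m + 1) + n + 1)) ^ (-s)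

open Finset Complex

/-- The generalized binomial coefficient `w.choose k` as a polynomial function of `w`. -/
noncomputable def cbinom (k : ℕ) (w : ℂ) : ℂ := ∏ i ∈ range k, (w - i) / (i + 1)

lemma differentiable_cbinom (k : ℕ) : Differentiable ℂ (cbinom k) := by
  unfold cbinom
  fun_prop

lemma succ_mul_cbinom_succ (k : ℕ) (w : ℂ) :
    (k + 1) * cbinom (k + 1) w = w * cbinom k (w - 1) := by
  induction k with
  | zero => simp [cbinom]
  | succ k ih =>
    have h1 : ((k : ℂ) + 1) ≠ 0 := by exact_mod_cast k.succ_ne_zero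
    have h2 : ((k : ℂ) + 1 + 1) ≠ 0 := by exact_mod_cast (k + 1).succ_ne_zero
    have e1 : cbinom (k + 1 + 1) w = cbinom (k + 1) w * ((w - (k + 1)) / (k + 1 + 1)) := by
      simp only [cbinom, prod_range_succ]
      push_cast
      ring
    have e2 : cbinom (k + 1) (w - 1) = cbinom k (w - 1) * ((w - 1 - k) / (k + 1)) := by
      simp only [cbinom, prod_range_succ]
    rw [e1, e2, ← mul_assoc w, ← ih]
    push_cast
    field_simp
    ring

lemma norm_one_add_cpow_sub_le (M : ℕ) : ∀ R : ℝ, ∃ C : ℝ, ∀ w : ℂ, ‖w‖ ≤ R →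
    ∀ u ∈ Set.Icc (0 : ℝ) 1,
      ‖((1 + u : ℝ) : ℂ) ^ w - ∑ k ∈ range M, cbinom k w * (u : ℂ) ^ k‖ ≤ C * u ^ M := by
  induction M with
  | zero =>
    intro R
    refine ⟨2 ^ R, fun w hw u hu => ?_⟩
    have h1 : (1 : ℝ) ≤ 1 + u := by linarith [hu.1]
    simp only [range_zero, sum_empty, sub_zero, pow_zero, mul_one]
    rw [norm_cpow_eq_rpow_re_of_pos (by linarith)]
    calc (1 + u) ^ w.re ≤ (1 + u) ^ R :=
          Real.rpow_le_rpow_of_exponent_le h1 ((re_le_norm w).trans hw)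
      _ ≤ 2 ^ R := Real.rpow_le_rpow (by linarith) (by linarith [hu.2])
          ((norm_nonneg w).trans hw)
  | succ M ih =>
    intro R
    obtain ⟨C, hC⟩ := ih (R + 1)
    refine ⟨R * C, fun w hw u hu => ?_⟩
    have hR : 0 ≤ R := (norm_nonneg w).trans hw
    have hw1 : ‖w - 1‖ ≤ R + 1 := by
      refine (norm_sub_le _ _).trans ?_
      simpa using hw
    have hC0 : 0 ≤ C := by
      simpa using (norm_nonneg _).trans (hC (w - 1) hw1 1 (by simp))
    set F : ℝ → ℂ := fun t =>
      ((1 + t : ℝ) : ℂ) ^ w - ∑ k ∈ range (M + 1), cbinom k w * (t : ℂ) ^ k with hF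
    have hder : ∀ t ∈ Set.Icc (0 : ℝ) u, HasDerivWithinAt F
        (w * (((1 + t : ℝ) : ℂ) ^ (w - 1) - ∑ k ∈ range M, cbinom k (w - 1) * (t : ℂ) ^ k))
        (Set.Icc 0 u) t := by
      intro t ht
      have hid : HasDerivAt (fun t : ℝ => (t : ℂ)) 1 t := ofRealCLM.hasDerivAt
      have hslit : 1 + (t : ℂ) ∈ slitPlane := by
        rw [← ofReal_one, ← ofReal_add, ofReal_mem_slitPlane]
        linarith [ht.1]
      have h1 : HasDerivAt (fun t : ℝ => ((1 + t : ℝ) : ℂ) ^ w)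
          (w * ((1 + t : ℝ) : ℂ) ^ (w - 1)) t := by
        simpa using (((hasDerivAt_id (t : ℂ)).const_add 1).cpow_const (c := w) hslit).comp_ofReal
      have h2 : HasDerivAt (fun t : ℝ => ∑ k ∈ range (M + 1), cbinom k w * (t : ℂ) ^ k)
          (∑ k ∈ range (M + 1), cbinom k w * (k * (t : ℂ) ^ (k - 1) * 1)) t :=
        HasDerivAt.fun_sum fun k _ => (hid.pow k).const_mul _
      refine ((h1.sub h2).congr_deriv ?_).hasDerivWithinAt
      rw [sum_range_succ', mul_sub, mul_sum]
      simp only [Nat.cast_zero, zero_mul, mul_zero, add_zero, mul_one]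
      congr 1
      refine sum_congr rfl fun k _ => ?_
      rw [← mul_assoc w, ← succ_mul_cbinom_succ]
      push_cast
      ring
    have hbd : ∀ t ∈ Set.Ico (0 : ℝ) u,
        ‖w * (((1 + t : ℝ) : ℂ) ^ (w - 1) - ∑ k ∈ range M, cbinom k (w - 1) * (t : ℂ) ^ k)‖
          ≤ R * (C * u ^ M) := by
      intro t ht
      rw [norm_mul]
      refine mul_le_mul hw ((hC (w - 1) hw1 t ⟨ht.1, ht.2.le.trans hu.2⟩).trans ?_)
        (norm_nonneg _) hR
      exact mul_le_mul_of_nonneg_left (pow_le_pow_left₀ ht.1 ht.2.le M) hC0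
    have := norm_image_sub_le_of_norm_deriv_le_segment' hder hbd u ⟨hu.1, le_rfl⟩
    have hF0 : F 0 = 0 := by
      simp only [hF, sum_range_succ']
      simp [cbinom]
    rw [hF0, sub_zero] at this
    calc _ ≤ _ := this
      _ = _ := by ring

/-- `φ s u` has the asymptotic expansion `∑ k, c k s * u ^ k` as `u → 0⁺`, with entire
coefficients and remainders controlled on `0 < u ≤ 1`, locally uniformly in `s`. -/
def HasExpansion (φ : ℂ → ℝ → ℂ) (c : ℕ → ℂ → ℂ) : Prop :=
  (∀ k, Differentiable ℂ (c k)) ∧ ∀ (M : ℕ) (R : ℝ), ∃ C : ℝ, ∀ s : ℂ, ‖s‖ ≤ R →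
    ∀ u ∈ Set.Ioc (0 : ℝ) 1, ‖φ s u - ∑ k ∈ range M, c k s * (u : ℂ) ^ k‖ ≤ C * u ^ M

namespace HasExpansion

variable {φ ψ : ℂ → ℝ → ℂ} {c d : ℕ → ℂ → ℂ}

lemma congr (h : HasExpansion φ c) (e : ∀ s u, ψ s u = φ s u) : HasExpansion ψ c :=
  (funext₂ e : ψ = φ) ▸ h

lemma one_add_cpow (α β : ℂ) :
    HasExpansion (fun s u => ((1 + u : ℝ) : ℂ) ^ (α * s + β))
      (fun k s => cbinom k (α * s + β)) := by
  refine ⟨fun k => (differentiable_cbinom k).comp (by fun_prop), fun M R => ?_⟩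
  obtain ⟨C, hC⟩ := norm_one_add_cpow_sub_le M (‖α‖ * R + ‖β‖)
  refine ⟨C, fun s hs u hu => hC _ ?_ u ⟨hu.1.le, hu.2⟩⟩
  refine (norm_add_le _ _).trans ?_
  rw [norm_mul]
  gcongr

lemma sub (h : HasExpansion φ c) (h' : HasExpansion ψ d) :
    HasExpansion (fun s u => φ s u - ψ s u) (fun k s => c k s - d k s) := by
  refine ⟨fun k => (h.1 k).sub (h'.1 k), fun M R => ?_⟩
  obtain ⟨C, hC⟩ := h.2 M R
  obtain ⟨D, hD⟩ := h'.2 M R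
  refine ⟨C + D, fun s hs u hu => ?_⟩
  simp only [sub_mul, sum_sub_distrib]
  rw [sub_sub_sub_comm, add_mul]
  exact (norm_sub_le _ _).trans (add_le_add (hC s hs u hu) (hD s hs u hu))

lemma mul_left (h : HasExpansion φ c) {A : ℂ → ℂ} (hA : Differentiable ℂ A) :
    HasExpansion (fun s u => A s * φ s u) (fun k s => A s * c k s) := by
  refine ⟨fun k => hA.mul (h.1 k), fun M R => ?_⟩
  obtain ⟨C, hC⟩ := h.2 M R
  obtain ⟨B, hB⟩ := (isCompact_closedBall (0 : ℂ) R).exists_bound_of_continuousOn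
    hA.continuous.continuousOn
  refine ⟨B * C, fun s hs u hu => ?_⟩
  have hB' := hB s (by simpa using hs)
  simp only [mul_assoc]
  rw [← mul_sum, ← mul_sub, norm_mul]
  exact mul_le_mul hB' (hC s hs u hu) (norm_nonneg _) ((norm_nonneg _).trans hB')

lemma mul_var (h : HasExpansion φ c) :
    HasExpansion (fun s u => (u : ℂ) * φ s u)
      (fun k s => if k = 0 then 0 else c (k - 1) s) := by
  refine ⟨fun k => ?_, fun M R => ?_⟩
  · by_cases hk : k = 0
    · simp [hk]
    · simpa [hk] using h.1 (k - 1)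
  · cases M with
    | zero =>
      obtain ⟨C, hC⟩ := h.2 0 R
      refine ⟨C, fun s hs u hu => ?_⟩
      have := hC s hs u hu
      simp only [range_zero, sum_empty, sub_zero, pow_zero, mul_one] at this ⊢
      rw [norm_mul, norm_real, Real.norm_of_nonneg hu.1.le]
      exact (mul_le_of_le_one_left (norm_nonneg _) hu.2).trans this
    | succ M =>
      obtain ⟨C, hC⟩ := h.2 M R
      refine ⟨C, fun s hs u hu => ?_⟩
      have e : ∑ k ∈ range (M + 1), (if k = 0 then 0 else c (k - 1) s) * (u : ℂ) ^ k
          = u * ∑ k ∈ range M, c k s * (u : ℂ) ^ k := by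
        rw [sum_range_succ', mul_sum]
        simp only [Nat.add_eq_zero_iff, one_ne_zero, and_false, if_false, if_true,
          add_tsub_cancel_right, zero_mul, add_zero]
        exact sum_congr rfl fun k _ => by ring
      rw [e, ← mul_sub, norm_mul, norm_real, Real.norm_of_nonneg hu.1.le]
      calc u * _ ≤ u * (C * u ^ M) := mul_le_mul_of_nonneg_left (hC s hs u hu) hu.1.le
        _ = _ := by ring

lemma mul_var_pow (h : HasExpansion φ c) (n : ℕ) :
    HasExpansion (fun s u => (u : ℂ) ^ n * φ s u)
      (fun k s => if k < n then 0 else c (k - n) s) := by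
  induction n with
  | zero => simpa using h
  | succ n ih =>
    convert ih.mul_var using 3 with s u k s
    · ring
    · rcases k with _ | k
      · simp
      · simp [Nat.add_sub_add_right]

lemma coeff_eq_zero (h : HasExpansion φ c) {s : ℂ} {M : ℕ}
    (hφ : ∀ u ∈ Set.Ioc (0 : ℝ) 1, φ s u = 0) (hc : ∀ k < M, c k s = 0) : c M s = 0 := by
  obtain ⟨C, hC⟩ := h.2 (M + 1) ‖s‖
  have key : ∀ u ∈ Set.Ioc (0 : ℝ) 1, ‖c M s‖ ≤ C * u := by
    intro u hu
    have := hC s le_rfl u hu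
    rw [hφ u hu, sum_range_succ, sum_eq_zero, zero_add, zero_sub, norm_neg, norm_mul, norm_pow,
      norm_real, Real.norm_of_nonneg hu.1.le, pow_succ', ← mul_assoc] at this
    · exact le_of_mul_le_mul_right this (pow_pos hu.1 M)
    · intro k hk
      simp [hc k (mem_range.1 hk)]
  have ht : Filter.Tendsto (fun u : ℝ => C * u) (nhdsWithin 0 (Set.Ioi 0)) (nhds 0) := by
    have : Continuous fun u : ℝ => C * u := by fun_prop
    simpa using (this.tendsto 0).mono_left nhdsWithin_le_nhds
  have : ‖c M s‖ ≤ 0 := ge_of_tendsto ht <| by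
    filter_upwards [Ioc_mem_nhdsGT (zero_lt_one' ℝ)] with u hu using key u hu
  simpa using this

end HasExpansion

/-- The defect `x ^ (2 * s - 1) * (H s * (x * (x + 1)) ^ (-s) - (A x - A (x + 1)))` at `x = 1 / u`,
where `A x = ∑ k ∈ range N, (2 * s + k - 2) * T k s * x ^ (1 - 2 * s - k)`. -/
noncomputable def telescopeDefect (H : ℂ → ℂ) (T : ℕ → ℂ → ℂ) (N : ℕ) (s : ℂ) (u : ℝ) : ℂ :=
  H s * (u * ((1 + u : ℝ) : ℂ) ^ (-s)) - ∑ k ∈ range N, (2 * s + k - 2) * T k s *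
    ((u : ℂ) ^ k * (1 - ((1 + u : ℝ) : ℂ) ^ (1 - 2 * s - k)))

lemma hasExpansion_pow_mul_one_sub (k : ℕ) :
    HasExpansion (fun s u => (u : ℂ) ^ k * (1 - ((1 + u : ℝ) : ℂ) ^ (1 - 2 * s - k)))
      (fun j s => if j < k then 0 else
        cbinom (j - k) 0 - cbinom (j - k) (1 - 2 * s - k)) := by
  have h1 := HasExpansion.one_add_cpow 0 0
  have h2 := HasExpansion.one_add_cpow (-2) (1 - k)
  have e : ∀ s : ℂ, -2 * s + (1 - k) = 1 - 2 * s - k := fun s => by ring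
  simp only [zero_mul, add_zero, cpow_zero, e] at h1 h2
  exact (h1.sub h2).mul_var_pow k

/-- Coefficients for which the telescoping defect vanishes to order `N + 3`. -/
lemma exists_telescope_coeffs (N : ℕ) :
    ∃ (H : ℂ → ℂ) (T c : ℕ → ℂ → ℂ), Differentiable ℂ H ∧ (∀ k, Differentiable ℂ (T k)) ∧
      H 0 ≠ 0 ∧ T 0 0 = H 0 / 2 ∧ T 1 0 = 0 ∧ T 2 0 = H 0 / 12 ∧ (∀ k ≥ 3, T k 0 = 0) ∧
      HasExpansion (telescopeDefect H T (N + 3)) c ∧ ∀ j ≤ N + 3, c j = 0 := by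
  induction N with
  | zero =>
    let T : ℕ → ℂ → ℂ := fun k s => if k = 0 then 2 * s + 1 else
      if k = 2 then (1 - s) * (2 * s - 1) * (2 * s - 2) / 12 else 0
    have hT : ∀ k, Differentiable ℂ (T k) := by
      intro k
      simp only [T]
      split_ifs <;> fun_prop
    have hpow := (HasExpansion.one_add_cpow (-1) 0).mul_var.mul_left
      (A := fun s => (2 * s - 1) * (2 * s + 1) * (2 * s - 2)) (by fun_prop)
    have h0 := (hasExpansion_pow_mul_one_sub 0).mul_left
      (A := fun s => (2 * s + 0 - 2) * (2 * s + 1)) (by fun_prop)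
    have h2 := (hasExpansion_pow_mul_one_sub 2).mul_left
      (A := fun s => (2 * s + 2 - 2) * ((1 - s) * (2 * s - 1) * (2 * s - 2) / 12)) (by fun_prop)
    refine ⟨fun s => (2 * s - 1) * (2 * s + 1) * (2 * s - 2), T, _, by fun_prop, hT, by norm_num,
      by norm_num [T], by norm_num [T], by norm_num [T], fun k hk => ?_, ((hpow.sub h0).sub h2).congr fun s u => ?_, ?_⟩
    · rw [show T k = fun _ => 0 from ?_]
      funext s
      simp only [T]
      rw [if_neg (by omega), if_neg (by omega)]
    · simp only [telescopeDefect, T, sum_range_succ]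
      simp
      ring
    · intro j hj
      funext s
      interval_cases j <;> simp [cbinom, prod_range_succ] <;> ring
  | succ N ih =>
    obtain ⟨H, T, c, hH, hT, h0, hT0, hT1, hT2, hT3, hexp, hc⟩ := ih
    set B : ℂ → ℂ := fun s => (2 * s + (N + 3 : ℕ) - 1) * (2 * s + (N + 3 : ℕ) - 2) with hB
    have hBd : Differentiable ℂ B := by
      simp only [hB]
      fun_prop
    have hB0 : B 0 ≠ 0 := by
      have e1 : ((N : ℂ) + 2) ≠ 0 := by exact_mod_cast (N + 1).succ_ne_zero
      have e2 : ((N : ℂ) + 1) ≠ 0 := by exact_mod_cast N.succ_ne_zero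
      have : B 0 = (N + 2) * (N + 1) := by
        simp only [hB]
        push_cast
        ring
      rw [this]
      exact mul_ne_zero e1 e2
    have hc0 : c (N + 4) 0 = 0 := by
      refine hexp.coeff_eq_zero (fun u hu => ?_) fun k hk => by rw [hc k (by omega)]; rfl
      have hu1 : ((1 + u : ℝ) : ℂ) ^ (1 : ℂ) = 1 + u := by simp
      rw [telescopeDefect, sum_eq_single_of_mem 0 (by simp)]
      · simp only [mul_zero, zero_add, Nat.cast_zero, sub_zero, neg_zero, cpow_zero, hu1, hT0]
        ring
      · intro k _ hk
        rcases k with _ | _ | _ | k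
        · simp at hk
        · simp [hT1]
        · simp
        · simp [hT3 (k + 3) (by omega)]
    let T' : ℕ → ℂ → ℂ := Function.update (fun k s => B s * T k s) (N + 3) (c (N + 4))
    have hT' : ∀ k, k ≠ N + 3 → T' k = fun s => B s * T k s := fun k hk => by
      simp only [T', Function.update_of_ne hk]
    have hT'N : T' (N + 3) = c (N + 4) := by simp [T']
    have hnew := (hexp.mul_left hBd).sub ((hasExpansion_pow_mul_one_sub (N + 3)).mul_left
      (A := fun s => (2 * s + (N + 3 : ℕ) - 2) * c (N + 4) s)
      ((by fun_prop : Differentiable ℂ fun s : ℂ => 2 * s + (N + 3 : ℕ) - 2).mul (hexp.1 _)))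
    refine ⟨fun s => B s * H s, T', _, hBd.mul hH, fun k => ?_, mul_ne_zero hB0 h0, ?_, ?_, ?_,
      fun k hk => ?_, hnew.congr fun s u => ?_, ?_⟩
    rotate_left 5
    · rw [telescopeDefect, telescopeDefect, show N + 1 + 3 = N + 3 + 1 from rfl, sum_range_succ,
        hT'N, mul_sub (B s), mul_sum, ← sub_sub]
      congr 2
      · ring
      · refine sum_congr rfl fun k hk => ?_
        rw [hT' k (by have := mem_range.1 hk; omega)]
        ring
    · intro j hj
      funext s
      rcases Nat.lt_or_ge j (N + 3) with h | h
      · simp [hc j h.le, h]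
      · rcases h.eq_or_lt with rfl | h
        · simp [hc (N + 3) le_rfl, cbinom]
        · obtain rfl : j = N + 4 := by omega
          have : N + 4 - (N + 3) = 1 := by omega
          simp [this, cbinom, hB]
          ring
    · by_cases hk : k = N + 3
      · rw [hk, hT'N]
        exact hexp.1 _
      · rw [hT' k hk]
        exact hBd.mul (hT k)
    · rw [hT' 0 (by omega)]
      simp only [hT0]
      ring
    · rw [hT' 1 (by omega)]
      simp only [hT1, mul_zero]
    · rw [hT' 2 (by omega)]
      simp only [hT2]
      ring
    · by_cases hkN : k = N + 3
      · rw [hkN, hT'N, hc0]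
      · rw [hT' k hkN]
        simp only [hT3 k hk, mul_zero]

/-- `(w - 1) * ζ(w)`, with its removable singularity at `w = 1` filled in. -/
noncomputable def regularizedZeta : ℂ → ℂ :=
  Function.update (fun w => (w - 1) * riemannZeta w) 1 1

lemma differentiable_regularizedZeta : Differentiable ℂ regularizedZeta := by
  rw [← differentiableOn_univ,
    ← differentiableOn_compl_singleton_and_continuousAt_iff (c := 1) Filter.univ_mem]
  refine ⟨fun w hw => ?_, ?_⟩
  · have hw1 : w ≠ 1 := by simpa using hw
    refine DifferentiableAt.differentiableWithinAt ?_
    have h : DifferentiableAt ℂ (fun w => (w - 1) * riemannZeta w) w :=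
      (by fun_prop : DifferentiableAt ℂ (fun w : ℂ => w - 1) w).mul
        (differentiableAt_riemannZeta hw1)
    refine h.congr_of_eventuallyEq ?_
    filter_upwards [isOpen_ne.mem_nhds hw1] with z hz
    exact Function.update_of_ne hz _ _
  · exact continuousAt_update_same.2 riemannZeta_residue_one

lemma regularizedZeta_of_ne {w : ℂ} (hw : w ≠ 1) :
    regularizedZeta w = (w - 1) * riemannZeta w :=
  Function.update_of_ne hw _ _

lemma regularizedZeta_one : regularizedZeta 1 = 1 :=
  Function.update_self _ _ _

lemma regularizedZeta_neg_one : regularizedZeta (-1) = 1 / 6 := by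
  have h := riemannZeta_neg_nat_eq_bernoulli' 1
  rw [Nat.cast_one] at h
  rw [regularizedZeta_of_ne (by norm_num), h]
  norm_num [bernoulli'_two]

lemma summable_inv_add_one_pow_four : Summable fun n : ℕ => (((1 : ℝ) + n) ^ 4)⁻¹ := by
  have := (summable_nat_add_iff 1).2 (Real.summable_nat_pow_inv.2 (by norm_num : 1 < 4))
  simpa [add_comm] using this

lemma summable_inv_lattice_pow_four {a : ℝ} (ha : 1 ≤ a) :
    Summable fun p : ℕ × ℕ => ((a * (p.1 + 1) + p.2) ^ 4)⁻¹ := by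
  have h2 : Summable fun n : ℕ => (((n : ℝ) + 1) ^ 2)⁻¹ := by
    have := (summable_nat_add_iff 1).2 (Real.summable_nat_pow_inv.2 (by norm_num : 1 < 2))
    simpa using this
  refine Summable.of_nonneg_of_le (fun p => by positivity) (fun p => ?_)
    (h2.mul_of_nonneg h2 (fun n => by positivity) fun n => by positivity)
  have hx : (p.1 : ℝ) + 1 + p.2 ≤ a * (p.1 + 1) + p.2 := by
    have : (0 : ℝ) ≤ p.1 + 1 := by positivity
    nlinarith
  have hm : (0 : ℝ) ≤ p.1 := by positivity
  have hn : (0 : ℝ) ≤ p.2 := by positivity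
  rw [← mul_inv]
  refine inv_anti₀ (by positivity) ?_
  calc ((p.1 : ℝ) + 1) ^ 2 * ((p.2 : ℝ) + 1) ^ 2
      ≤ (a * (p.1 + 1) + p.2) ^ 2 * (a * (p.1 + 1) + p.2) ^ 2 := by
        exact mul_le_mul (pow_le_pow_left₀ (by positivity) (by linarith) 2)
          (pow_le_pow_left₀ (by positivity) (by linarith) 2) (by positivity) (by positivity)
    _ = _ := by ring

lemma one_le_lattice {a : ℝ} (ha : 1 ≤ a) (m n : ℕ) : 1 ≤ a * (m + 1) + n := by
  have hm : (0 : ℝ) ≤ m := by positivity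
  have hn : (0 : ℝ) ≤ n := by positivity
  nlinarith

lemma norm_cpow_mul_add_one_le {s : ℂ} (hs : 2 < s.re) {x : ℝ} (hx : 1 ≤ x) :
    ‖((x : ℂ) * (x + 1)) ^ (-s)‖ ≤ (x ^ 4)⁻¹ := by
  have hx0 : 0 < x := by linarith
  have e : (x : ℂ) * (x + 1) = ((x * (x + 1) : ℝ) : ℂ) := by push_cast; ring
  have h1 : x ^ 2 ≤ x * (x + 1) := by nlinarith
  rw [e, norm_cpow_eq_rpow_re_of_pos (by positivity), neg_re, Real.rpow_neg (by positivity)]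
  refine inv_anti₀ (by positivity) ?_
  calc x ^ 4 = (x ^ 2) ^ 2 := by ring
    _ ≤ (x * (x + 1)) ^ 2 := pow_le_pow_left₀ (by positivity) h1 2
    _ = (x * (x + 1)) ^ (2 : ℝ) := (Real.rpow_two _).symm
    _ ≤ _ := Real.rpow_le_rpow_of_exponent_le (by nlinarith) hs.le

/-- What is left of `H s * (x * (x + 1)) ^ (-s)` after subtracting a telescoping term. -/
noncomputable def telescopeRemainder (H : ℂ → ℂ) (T : ℕ → ℂ → ℂ) (N : ℕ) (s : ℂ) (x : ℝ) : ℂ :=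
  H s * ((x : ℂ) * (x + 1)) ^ (-s) - ∑ k ∈ range N, (2 * s + k - 2) * T k s *
    ((x : ℂ) ^ (1 - 2 * s - k) - ((x : ℂ) + 1) ^ (1 - 2 * s - k))

section Remainder

variable {H : ℂ → ℂ} {T c : ℕ → ℂ → ℂ}

lemma telescopeRemainder_eq (N : ℕ) (s : ℂ) {x : ℝ} (hx : 0 < x) :
    telescopeRemainder H T N s x =
      (x : ℂ) ^ (1 - 2 * s) * telescopeDefect H T N s x⁻¹ := by
  have hx' : (x : ℂ) ≠ 0 := by exact_mod_cast hx.ne'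
  have e1 : (x : ℂ) + 1 = (x : ℂ) * ((1 + x⁻¹ : ℝ) : ℂ) := by
    push_cast
    field_simp
  have e2 : ∀ w : ℂ, ((x : ℂ) + 1) ^ w = (x : ℂ) ^ w * ((1 + x⁻¹ : ℝ) : ℂ) ^ w := fun w => by
    rw [e1, mul_cpow_ofReal_nonneg hx.le (by positivity)]
  have e3 : ((x : ℂ) * (x + 1)) ^ (-s) = (x : ℂ) ^ (-s) * ((x : ℂ) + 1) ^ (-s) := by
    have := mul_cpow_ofReal_nonneg hx.le (by positivity : 0 ≤ x + 1) (-s)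
    push_cast at this
    exact this
  have e4 : (x : ℂ) ^ (1 - 2 * s) * (x⁻¹ : ℝ) = (x : ℂ) ^ (-s) * (x : ℂ) ^ (-s) := by
    rw [← cpow_add _ _ hx', show 1 - 2 * s = -s + -s + 1 by ring, cpow_add _ _ hx', cpow_one]
    push_cast
    field_simp
  have e5 : ∀ k : ℕ, (x : ℂ) ^ (1 - 2 * s - k) = (x : ℂ) ^ (1 - 2 * s) * ((x⁻¹ : ℝ) : ℂ) ^ k := by
    intro k
    rw [cpow_sub _ _ hx', cpow_natCast]
    push_cast
    rw [inv_pow, div_eq_mul_inv]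
  rw [telescopeRemainder, telescopeDefect, mul_sub, mul_sum]
  congr 1
  · rw [e3, e2, ← mul_assoc ((x : ℂ) ^ (-s)), ← e4]
    ring
  · refine sum_congr rfl fun k _ => ?_
    rw [e2, e5]
    ring

lemma norm_telescopeRemainder_le {N : ℕ} (h : HasExpansion (telescopeDefect H T (N + 3)) c)
    (hc : ∀ j ≤ N + 3, c j = 0) {ρ : ℝ} (hρ : 1 + 2 * ρ ≤ N) :
    ∃ C : ℝ, ∀ s : ℂ, ‖s‖ ≤ ρ → ∀ x : ℝ, 1 ≤ x →
      ‖telescopeRemainder H T (N + 3) s x‖ ≤ C * (x ^ 4)⁻¹ := by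
  obtain ⟨C, hC⟩ := h.2 (N + 4) ρ
  refine ⟨C, fun s hs x hx => ?_⟩
  have hx0 : 0 < x := by linarith
  have hd := hC s hs x⁻¹ ⟨by positivity, inv_le_one_of_one_le₀ hx⟩
  rw [sum_eq_zero fun k hk => by
    rw [hc k (by have := mem_range.1 hk; omega), Pi.zero_apply, zero_mul], sub_zero] at hd
  have hp : ‖(x : ℂ) ^ (1 - 2 * s)‖ ≤ x ^ N := by
    rw [norm_cpow_eq_rpow_re_of_pos hx0, ← Real.rpow_natCast]
    refine Real.rpow_le_rpow_of_exponent_le hx ?_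
    have := (abs_le.1 ((abs_re_le_norm s).trans hs)).1
    simp
    linarith
  rw [telescopeRemainder_eq _ _ hx0, norm_mul]
  calc _ ≤ x ^ N * (C * x⁻¹ ^ (N + 4)) := mul_le_mul hp hd (norm_nonneg _) (by positivity)
    _ = C * (x ^ 4)⁻¹ := by
      rw [pow_add, inv_pow, inv_pow]
      field_simp

lemma differentiable_telescopeRemainder (hH : Differentiable ℂ H)
    (hT : ∀ k, Differentiable ℂ (T k)) (N : ℕ) {x : ℝ} (hx : 0 < x) :
    Differentiable ℂ fun s => telescopeRemainder H T N s x := by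
  have hx' : (x : ℂ) ≠ 0 := by exact_mod_cast hx.ne'
  have hx1 : (x : ℂ) + 1 ≠ 0 := by exact_mod_cast (by linarith : x + 1 ≠ 0)
  have hx2 := mul_ne_zero hx' hx1
  unfold telescopeRemainder
  refine (hH.mul fun s => ?_).sub (Differentiable.fun_sum fun k _ => ?_)
  · exact (differentiableAt_id.neg).const_cpow (Or.inl hx2)
  · refine ((by fun_prop : Differentiable ℂ fun s : ℂ => 2 * s + k - 2).mul (hT k)).mul
      (Differentiable.sub (fun s => ?_) fun s => ?_)
    · exact (by fun_prop : DifferentiableAt ℂ (fun s : ℂ => 1 - 2 * s - k) s).const_cpow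
        (Or.inl hx')
    · exact (by fun_prop : DifferentiableAt ℂ (fun s : ℂ => 1 - 2 * s - k) s).const_cpow
        (Or.inl hx1)

lemma telescopeRemainder_zero (hT0 : T 0 0 = H 0 / 2) (hT1 : T 1 0 = 0)
    (hT3 : ∀ k ≥ 3, T k 0 = 0) (N : ℕ) (x : ℝ) : telescopeRemainder H T (N + 3) 0 x = 0 := by
  rw [telescopeRemainder, sum_eq_single_of_mem 0 (by simp)]
  · simp [hT0]
    ring
  · intro k _ hk
    rcases k with _ | _ | _ | k
    · simp at hk
    · simp [hT1]
    · simp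
    · simp [hT3 (k + 3) (by omega)]

lemma hasSum_cpow_sub_succ {x : ℝ} (hx : 1 ≤ x) {w : ℂ} (hw : w.re < -1) :
    HasSum (fun n : ℕ => ((x + n : ℝ) : ℂ) ^ w - (((x + n : ℝ) : ℂ) + 1) ^ w) ((x : ℂ) ^ w) := by
  have hs : Summable fun n : ℕ => ((x + n : ℝ) : ℂ) ^ w := by
    have h1 := (summable_nat_add_iff 1).2 (Real.summable_nat_rpow.2 hw)
    refine Summable.of_norm_bounded h1 fun n => ?_
    rw [norm_cpow_eq_rpow_re_of_pos (by positivity)]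
    push_cast
    exact Real.rpow_le_rpow_of_nonpos (by positivity) (by linarith) (by linarith)
  have hs1 := (summable_nat_add_iff 1).2 hs
  convert! hs.hasSum.sub hs1.hasSum using 1
  · funext n
    push_cast
    ring_nf
  · rw [hs.tsum_eq_zero_add]
    simp

lemma hasSum_telescopeRemainder (N : ℕ) {s : ℂ} (hs : 2 < s.re) {x : ℝ} (hx : 1 ≤ x) :
    HasSum (fun n : ℕ => telescopeRemainder H T N s (x + n))
      (H s * ∑' n : ℕ, (((x + n : ℝ) : ℂ) * ((x + n : ℝ) + 1)) ^ (-s) -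
        ∑ k ∈ range N, (2 * s + k - 2) * T k s * (x : ℂ) ^ (1 - 2 * s - k)) := by
  refine HasSum.sub (HasSum.mul_left _ (Summable.hasSum ?_)) (hasSum_sum fun k _ =>
    (hasSum_cpow_sub_succ hx ?_).mul_left _)
  · refine Summable.of_norm_bounded summable_inv_add_one_pow_four fun n => ?_
    have hn : (0 : ℝ) ≤ n := by positivity
    refine (norm_cpow_mul_add_one_le hs (by linarith)).trans ?_
    gcongr
  · have : (0 : ℝ) ≤ k := by positivity
    simp
    linarith

end Remainder

lemma hasSum_mul_add_one_cpow {a : ℝ} (ha : 0 < a) {w : ℂ} (hw : w.re < -1) :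
    HasSum (fun m : ℕ => ((a * (m + 1) : ℝ) : ℂ) ^ w) ((a : ℂ) ^ w * riemannZeta (-w)) := by
  have hre : 1 < (-w).re := by rw [neg_re]; linarith
  have hs : Summable fun m : ℕ => 1 / ((m : ℂ) + 1) ^ (-w) := by
    have := (summable_nat_add_iff 1).2 (Complex.summable_one_div_nat_cpow.2 hre)
    simpa using this
  rw [zeta_eq_tsum_one_div_nat_add_one_cpow hre]
  convert! hs.hasSum.mul_left ((a : ℂ) ^ w) using 2 with m
  rw [ofReal_mul, mul_cpow_ofReal_nonneg ha.le (by positivity), cpow_neg]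
  simp

lemma summable_norm_zetaS2_fst {s : ℂ} (hs : 2 < s.re) :
    Summable fun n : ℕ => ‖(((n : ℂ) + 1) * ((n : ℂ) + 2)) ^ (-s)‖ := by
  refine Summable.of_nonneg_of_le (fun _ => norm_nonneg _) (fun n => ?_)
    summable_inv_add_one_pow_four
  convert norm_cpow_mul_add_one_le hs (by simp : (1 : ℝ) ≤ 1 + n) using 3
  push_cast
  ring

lemma summable_norm_zetaS2_snd {a : ℝ} (ha : 1 ≤ a) {s : ℂ} (hs : 2 < s.re) :
    Summable fun p : ℕ × ℕ =>
      ‖(((a : ℂ) * (p.1 + 1) + p.2) * ((a : ℂ) * (p.1 + 1) + p.2 + 1)) ^ (-s)‖ := by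
  refine Summable.of_nonneg_of_le (fun _ => norm_nonneg _) (fun p => ?_)
    (summable_inv_lattice_pow_four ha)
  convert norm_cpow_mul_add_one_le hs (one_le_lattice ha p.1 p.2) using 3
  push_cast
  ring

/-- On every disc around `0`, the zeta function multiplied by a suitable entire function that
does not vanish at `0` extends analytically, with an explicit value at `0`. -/
lemma exists_mul_zetaS2_extension {a : ℝ} (ha : 1 ≤ a) (ρ : ℝ) :
    ∃ H G : ℂ → ℂ, Differentiable ℂ H ∧ H 0 ≠ 0 ∧
      DifferentiableOn ℂ G (Metric.ball 0 ρ) ∧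
      (∀ s ∈ Metric.ball (0 : ℂ) ρ, 2 < s.re → G s = H s * zetaS2 a s) ∧
      G 0 = H 0 * (-1 + (a : ℂ) / 6 + 1 / (6 * (a : ℂ))) := by
  have ha0 : 0 < a := by linarith
  have ha' : (a : ℂ) ≠ 0 := by exact_mod_cast ha0.ne'
  obtain ⟨N, hN⟩ := exists_nat_ge (1 + 2 * ρ)
  obtain ⟨H, T, c, hH, hT, hH0, hT0, hT1, hT2, hT3, hexp, hc⟩ := exists_telescope_coeffs N
  obtain ⟨C, hC⟩ := norm_telescopeRemainder_le hexp hc hN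
  have hball : ∀ s ∈ Metric.ball (0 : ℂ) ρ, ‖s‖ ≤ ρ := fun s hs => by
    simpa using (mem_ball_zero_iff.1 hs).le
  have hx1 : ∀ n : ℕ, (1 : ℝ) ≤ 1 + n := fun n => by simp
  refine ⟨H, fun s => (∑' n : ℕ, telescopeRemainder H T (N + 3) s (1 + n)) +
    (∑ k ∈ range (N + 3), (2 * s + k - 2) * T k s) +
    2 * ((∑' p : ℕ × ℕ, telescopeRemainder H T (N + 3) s (a * (p.1 + 1) + p.2)) +
      ∑ k ∈ range (N + 3), T k s * (a : ℂ) ^ (1 - 2 * s - k) * regularizedZeta (2 * s + k - 1)),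
    hH, hH0, ?_, fun s hs hs2 => ?_, ?_⟩
  · have d1 : DifferentiableOn ℂ
        (fun s => ∑' n : ℕ, telescopeRemainder H T (N + 3) s (1 + n)) (Metric.ball 0 ρ) :=
      differentiableOn_tsum_of_summable_norm (summable_inv_add_one_pow_four.mul_left C)
        (fun n => (differentiable_telescopeRemainder hH hT _
          (by linarith [hx1 n])).differentiableOn) Metric.isOpen_ball
        fun n s hs => hC s (hball s hs) _ (hx1 n)
    have d2 : DifferentiableOn ℂ (fun s => ∑' p : ℕ × ℕ,
        telescopeRemainder H T (N + 3) s (a * (p.1 + 1) + p.2)) (Metric.ball 0 ρ) :=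
      differentiableOn_tsum_of_summable_norm ((summable_inv_lattice_pow_four ha).mul_left C)
        (fun p => (differentiable_telescopeRemainder hH hT _
          (by linarith [one_le_lattice ha p.1 p.2])).differentiableOn) Metric.isOpen_ball
        fun p s hs => hC s (hball s hs) _ (one_le_lattice ha p.1 p.2)
    have d3 : Differentiable ℂ fun s => ∑ k ∈ range (N + 3), (2 * s + k - 2) * T k s :=
      Differentiable.fun_sum fun k _ =>
        (by fun_prop : Differentiable ℂ fun s : ℂ => 2 * s + k - 2).mul (hT k)
    have d4 : Differentiable ℂ fun s => ∑ k ∈ range (N + 3),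
        T k s * (a : ℂ) ^ (1 - 2 * s - k) * regularizedZeta (2 * s + k - 1) :=
      Differentiable.fun_sum fun k _ => ((hT k).mul fun s =>
        (by fun_prop : DifferentiableAt ℂ (fun s : ℂ => 1 - 2 * s - k) s).const_cpow
          (Or.inl ha')).mul (differentiable_regularizedZeta.comp (by fun_prop))
    exact (d1.add d3.differentiableOn).add ((d2.add d4.differentiableOn).const_mul 2)
  · have h1 := (hasSum_telescopeRemainder (H := H) (T := T) (N + 3) hs2 le_rfl).tsum_eq
    have e1 : ∑' n : ℕ, (((1 + n : ℝ) : ℂ) * ((1 + n : ℝ) + 1)) ^ (-s) =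
        ∑' n : ℕ, (((n : ℂ) + 1) * ((n : ℂ) + 2)) ^ (-s) := by
      congr with n
      congr 1
      push_cast
      ring
    rw [e1] at h1
    simp only [ofReal_one, one_cpow, mul_one] at h1
    have hsum : Summable fun p : ℕ × ℕ =>
        telescopeRemainder H T (N + 3) s (a * (p.1 + 1) + p.2) :=
      Summable.of_norm_bounded ((summable_inv_lattice_pow_four ha).mul_left C)
        fun p => hC s (hball s hs) _ (one_le_lattice ha p.1 p.2)
    have hx (m : ℕ) : 1 ≤ a * (m + 1) := by simpa using one_le_lattice ha m 0
    have hinner : ∀ m : ℕ, ∑' n : ℕ, telescopeRemainder H T (N + 3) s (a * (m + 1) + n) =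
        H s * (∑' n : ℕ,
          (((a : ℂ) * (m + 1) + n) * ((a : ℂ) * (m + 1) + n + 1)) ^ (-s)) -
        ∑ k ∈ range (N + 3), (2 * s + k - 2) * T k s *
          ((a * (m + 1) : ℝ) : ℂ) ^ (1 - 2 * s - k) := fun m => by
      rw [(hasSum_telescopeRemainder (H := H) (T := T) (N + 3) hs2 (hx m)).tsum_eq]
      push_cast
      rfl
    have hre (k : ℕ) : (1 - 2 * s - k).re < -1 := by
      have : (0 : ℝ) ≤ k := by positivity
      simp
      linarith
    have hpoly : HasSum (fun m : ℕ => ∑ k ∈ range (N + 3), (2 * s + k - 2) * T k s *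
          ((a * (m + 1) : ℝ) : ℂ) ^ (1 - 2 * s - k))
        (∑ k ∈ range (N + 3), T k s * (a : ℂ) ^ (1 - 2 * s - k) *
          regularizedZeta (2 * s + k - 1)) := by
      refine hasSum_sum fun k _ => ?_
      convert! (hasSum_mul_add_one_cpow ha0 (hre k)).mul_left ((2 * s + k - 2) * T k s) using 1
      have hne : 2 * s + k - 1 ≠ 1 := fun h => by
        have h2 := hre k
        rw [show 1 - 2 * s - (k : ℂ) = -(2 * s + k - 1) by ring, h] at h2
        simp at h2
      rw [regularizedZeta_of_ne hne, show -(1 - 2 * s - (k : ℂ)) = 2 * s + k - 1 by ring]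
      ring
    have hbase := ((summable_norm_zetaS2_snd ha hs2).of_norm.prod).hasSum.mul_left (H s)
    have h2 : ∑' p : ℕ × ℕ, telescopeRemainder H T (N + 3) s (a * (p.1 + 1) + p.2) = _ :=
      hsum.tsum_prod.trans ((tsum_congr hinner).trans (hbase.sub hpoly).tsum_eq)
    simp only [h1, h2, zetaS2]
    ring
  · simp only [telescopeRemainder_zero hT0 hT1 hT3, tsum_zero]
    rw [sum_eq_single_of_mem 0 (by simp)]
    · have hsub : ({0, 2} : Finset ℕ) ⊆ range (N + 3) := by
        intro k hk
        simp at hk ⊢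
        omega
      rw [← sum_subset hsub, sum_pair (by norm_num)]
      · have e1 : 2 * (0 : ℂ) + (0 : ℕ) - 1 = -1 := by norm_num
        have e2 : 2 * (0 : ℂ) + (2 : ℕ) - 1 = 1 := by norm_num
        have e3 : (1 : ℂ) - 2 * 0 - (0 : ℕ) = 1 := by norm_num
        have e4 : (1 : ℂ) - 2 * 0 - (2 : ℕ) = -1 := by norm_num
        rw [e1, e2, e3, e4, regularizedZeta_one, regularizedZeta_neg_one, hT0, hT2, cpow_one,
          cpow_neg_one]
        push_cast
        field_simp
        ring
      · intro k _ hk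
        rcases k with _ | _ | _ | k
        · simp at hk
        · simp [hT1]
        · simp at hk
        · simp [hT3 (k + 3) (by omega)]
    · intro k _ hk
      rcases k with _ | _ | _ | k
      · simp at hk
      · simp [hT1]
      · simp
      · simp [hT3 (k + 3) (by omega)]

/-- for `a ≥ 1`, the series defining `Z(s) = ζ(s, Δ_{S²_{1/a}})` converge
absolutely for `Re s > 2`, and every analytic continuation `f` of `Z` to `0` satisfies
`f(0) = −1 + a/6 + 1/(6a)`. -/
theorem stmt11 (a : ℝ) (ha : 1 ≤ a) :
    (∀ s : ℂ, 2 < s.re →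
      Summable (fun n : ℕ => ‖(((n : ℂ) + 1) * ((n : ℂ) + 2)) ^ (-s)‖) ∧
      Summable (fun p : ℕ × ℕ =>
        ‖(((a : ℂ) * (p.1 + 1) + p.2) * ((a : ℂ) * (p.1 + 1) + p.2 + 1)) ^ (-s)‖)) ∧
    ∀ f : ℂ → ℂ, IsContinuationAt (zetaS2 a) 2 0 f →
      f 0 = -1 + (a : ℂ) / 6 + 1 / (6 * (a : ℂ)) := by
  refine ⟨fun s hs => ⟨summable_norm_zetaS2_fst hs, summable_norm_zetaS2_snd ha hs⟩, ?_⟩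
  rintro f ⟨U, hU, hUc, h0, hUsub, hf, hfF⟩
  have h3 : (3 : ℂ) ∈ U := hUsub (by simp; norm_num)
  obtain ⟨γ, hγ⟩ := (hU.isConnected_iff_isPathConnected.1 hUc).joinedIn 0 h0 3 h3
  obtain ⟨ρ, -, hρ⟩ := (isCompact_range γ.continuous).isBounded.subset_ball_lt 0 (0 : ℂ)
  obtain ⟨H, G, hH, hH0, hG, hGF, hG0⟩ := exists_mul_zetaS2_extension ha ρ
  have hrange : Set.range γ ⊆ U ∩ Metric.ball 0 ρ :=
    Set.subset_inter (Set.range_subset_iff.2 hγ) hρ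
  have hmem0 : (0 : ℂ) ∈ Set.range γ := ⟨0, γ.source⟩
  have hmem3 : (3 : ℂ) ∈ Set.range γ := ⟨1, γ.target⟩
  set V := connectedComponentIn (U ∩ Metric.ball 0 ρ) (0 : ℂ) with hV
  have hVU : V ⊆ U ∩ Metric.ball 0 ρ := connectedComponentIn_subset _ _
  have hVr : Set.range γ ⊆ V :=
    (isPreconnected_range γ.continuous).subset_connectedComponentIn hmem0 hrange
  have hVo : IsOpen V := (hU.inter Metric.isOpen_ball).connectedComponentIn
  have hGan : AnalyticOnNhd ℂ G V := fun z hz =>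
    hG.analyticOnNhd Metric.isOpen_ball z (hVU hz).2
  have hHf : AnalyticOnNhd ℂ (fun s => H s * f s) V := fun z hz =>
    (hH.analyticAt z).mul (hf z (hVU hz).1)
  have hev : (fun s => H s * f s) =ᶠ[nhds 3] G := by
    have hre : {s : ℂ | 2 < s.re} ∈ nhds (3 : ℂ) :=
      (isOpen_lt continuous_const continuous_re).mem_nhds (by simp; norm_num)
    filter_upwards [hre, hVo.mem_nhds (hVr hmem3)] with s hs hsV
    rw [hGF s (hVU hsV).2 hs, hfF s hs]
  have := hHf.eqOn_of_preconnected_of_eventuallyEq hGan isPreconnected_connectedComponentIn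
    (hVr hmem3) hev (hVr hmem0)
  exact mul_left_cancel₀ hH0 (this.trans hG0)
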